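/- Let ζ belong to the resolvent set of 𝒟_ε on L²(𝕋). Then for every ν > 0, νζ belongs to the resolvent set of ℳ_{ν,ε} and (ℳ_{ν,ε} − νζ)⁻¹ = (1/ν)(𝒟_ε − ζ)⁻¹ + u_ε(ζ,y)/(iεν²(ε² + ζ))·Π₀, where u_ε(ζ,y) := (𝒟_ε − ζ)⁻¹U''(y) = U(y) + (ε² + ζ)(𝒟_ε − ζ)⁻¹U(y). Moreover the mapping ζ ↦ u_ε(ζ,·) is analytic on the half-plane {z ∈ ℂ : Re z > −1} with values in L²(𝕋). -/

import Mathlib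

open Complex
open scoped ComplexConjugate

noncomputable section

/-- Fourier-side model of a function on `𝕋 = ℝ/2πℤ`: `c j` is the `j`-th Fourier coefficient. -/
abbrev FC : Type := ℤ → ℂ

/-- membership in `L²(𝕋)` -/
def memL2 (c : FC) : Prop := Summable fun j : ℤ => ‖c j‖ ^ 2

/-- membership in the Sobolev space `H^s(𝕋)` -/
def memHs (s : ℝ) (c : FC) : Prop :=
  Summable fun j : ℤ => (1 + (j : ℝ) ^ 2) ^ s * ‖c j‖ ^ 2

/-- squared `L²(𝕋)` norm: `∫_𝕋 |f|² = 2π ∑ |f_j|²` -/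
def L2normSq (c : FC) : ℝ := (2 * Real.pi) * ∑' j : ℤ, ‖c j‖ ^ 2

def L2norm (c : FC) : ℝ := Real.sqrt (L2normSq c)

/-- the `H^s(𝕋)` Sobolev norm -/
def HsNorm (s : ℝ) (c : FC) : ℝ :=
  Real.sqrt ((2 * Real.pi) * ∑' j : ℤ, (1 + (j : ℝ) ^ 2) ^ s * ‖c j‖ ^ 2)

/-- `L²(𝕋)` inner product `⟨f,g⟩ = ∫_𝕋 f ḡ = 2π ∑ f_j ḡ_j` (linear in the first entry) -/
def L2inner (f g : FC) : ℂ := (2 * Real.pi) * ∑' j : ℤ, f j * conj (g j)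

/-- pointwise product of two functions, i.e. convolution of Fourier coefficients -/
def fmul (U c : FC) : FC := fun j => ∑' k : ℤ, U (j - k) * c k

/-- Fourier coefficients of the second derivative `U''` -/
def dd (U : FC) : FC := fun j => -(j : ℂ) ^ 2 * U j

/-- the zero-average primitive `∂_y⁻¹U` -/
def invDer (U : FC) : FC := fun j => if j = 0 then 0 else U j / (Complex.I * (j : ℂ))

/-- the average projection `Π₀` -/
def Pi0 (c : FC) : FC := fun j => if j = 0 then c 0 else 0

/-- `Π_≠ = Id - Π₀` -/
def PiNe (c : FC) : FC := fun j => if j = 0 then 0 else c j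

/-- `𝒟_ε = ∂_yy - ε²` -/
def Dop (ε : ℝ) (c : FC) : FC := fun j => -((((j : ℝ) ^ 2 + ε ^ 2 : ℝ)) : ℂ) * c j

/-- `(-∂_yy + ε²)⁻¹` -/
def invD (ε : ℝ) (c : FC) : FC := fun j => (((1 / ((j : ℝ) ^ 2 + ε ^ 2) : ℝ)) : ℂ) * c j

/-- the Rayleigh-type operator `ℛ_ε = U + U''(-∂_yy + ε²)⁻¹ Π_≠` -/
def Rop (ε : ℝ) (U c : FC) : FC := fun j => fmul U c j + fmul (dd U) (invD ε (PiNe c)) j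

/-- the leading operator `ℳ_{ν,ε} = ν𝒟_ε - (i/ε) U'' Π₀` -/
def Mop (ν ε : ℝ) (U c : FC) : FC :=
  fun j => (ν : ℂ) * Dop ε c j - Complex.I / (ε : ℂ) * c 0 * dd U j

/-- the full linearized operator `ℒ_{ν,ε} = ℳ_{ν,ε} - iεℛ_ε` -/
def Lop (ν ε : ℝ) (U c : FC) : FC :=
  fun j => Mop ν ε U c j - Complex.I * (ε : ℂ) * Rop ε U c j

/-- conjugate-symmetry of the Fourier coefficients, i.e. `U` is real valued -/
def realSymm (U : FC) : Prop := ∀ j : ℤ, U (-j) = conj (U j)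

/-- the Fourier coefficients of a (real-valued) function on `𝕋 = ℝ/2πℤ` -/
def fCoeff (U : ℝ → ℝ) : FC := fun j =>
  (1 / (2 * Real.pi)) * ∫ y in (0:ℝ)..(2 * Real.pi),
    Complex.exp (-(Complex.I * (j : ℂ) * (y : ℂ))) * (U y : ℂ)

/-- `u_ε(ζ,·) := (𝒟_ε - ζ)⁻¹ U''`: its `j`-th Fourier coefficient is
`-j²U_j/(-(j²+ε²)-ζ) = j²U_j/(j²+ε²+ζ)`. -/
def uEps (ε : ℝ) (ζ : ℂ) (U : FC) : FC :=
  fun j => (j : ℂ) ^ 2 * U j / ((((j : ℝ) ^ 2 + ε ^ 2 : ℝ) : ℂ) + ζ)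

/-- the right-hand side of the Sherman–Morrison resolvent formula
`(ℳ_{ν,ε} - νζ)⁻¹ = (1/ν)(𝒟_ε - ζ)⁻¹ + u_ε(ζ,y)/(iεν²(ε²+ζ)) Π₀`. -/
def resM (ν ε : ℝ) (ζ : ℂ) (U : FC) (f : FC) : FC :=
  fun j => (1 / (ν : ℂ)) * (f j / (-(((j : ℝ) ^ 2 + ε ^ 2 : ℝ) : ℂ) - ζ))
    + f 0 / (Complex.I * (ε : ℂ) * (ν : ℂ) ^ 2 * (((ε ^ 2 : ℝ) : ℂ) + ζ))
      * uEps ε ζ U j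

theorem fCoeff_eq_fourierCoeffOn (V : ℝ → ℝ) (n : ℤ) :
    fCoeff V n = fourierCoeffOn Real.two_pi_pos (fun x => (V x : ℂ)) n := by
  rw [fourierCoeffOn_eq_integral, fCoeff, Complex.real_smul]
  push_cast
  rw [sub_zero]
  congr 1
  refine intervalIntegral.integral_congr fun x _ => ?_
  have hpi : (Real.pi : ℂ) ≠ 0 := by exact_mod_cast Real.pi_ne_zero
  simp only [fourier_coe_apply, smul_eq_mul]
  congr 2
  push_cast
  field_simp
  ring

/-- Differentiating a periodic `C¹` function multiplies its Fourier coefficients by `i n`. -/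
theorem fCoeff_deriv {V : ℝ → ℝ} (hV : ContDiff ℝ 1 V)
    (hper : Function.Periodic V (2 * Real.pi)) {n : ℤ} (hn : n ≠ 0) :
    fCoeff (deriv V) n = Complex.I * n * fCoeff V n := by
  have hd : ∀ x ∈ Set.uIcc 0 (2 * Real.pi),
      HasDerivAt (fun x => (V x : ℂ)) ((deriv V x : ℝ) : ℂ) x := fun x _ =>
    ((hV.differentiable one_ne_zero).differentiableAt.hasDerivAt).ofReal_comp
  have hi : IntervalIntegrable (fun x => ((deriv V x : ℝ) : ℂ)) MeasureTheory.volume 0 (2 * Real.pi) :=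
    (Complex.continuous_ofReal.comp (hV.continuous_deriv le_rfl)).intervalIntegrable _ _
  have hV0 : V (2 * Real.pi) = V 0 := by simpa using hper 0
  have hpi : (Real.pi : ℂ) ≠ 0 := by exact_mod_cast Real.pi_ne_zero
  have hn' : (n : ℂ) ≠ 0 := by exact_mod_cast hn
  rw [fCoeff_eq_fourierCoeffOn, fCoeff_eq_fourierCoeffOn,
    fourierCoeffOn_of_hasDerivAt Real.two_pi_pos hn hd hi, hV0]
  push_cast
  field_simp
  simp
  ring

theorem memL2_fCoeff {V : ℝ → ℝ} (hV : Continuous V) : memL2 (fCoeff V) := by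
  have hc : Continuous fun x => (V x : ℂ) := Complex.continuous_ofReal.comp hV
  have hL : MeasureTheory.MemLp (fun x => (V x : ℂ)) 2
      (MeasureTheory.volume.restrict (Set.Ioc 0 (2 * Real.pi))) := by
    obtain ⟨C, hC⟩ := (isCompact_Icc (a := (0 : ℝ)) (b := 2 * Real.pi)).exists_bound_of_continuousOn
      hc.continuousOn
    refine MeasureTheory.MemLp.of_bound hc.aestronglyMeasurable C ?_
    filter_upwards [MeasureTheory.ae_restrict_mem measurableSet_Ioc] with x hx
    exact hC x (Set.Ioc_subset_Icc_self hx)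
  have h := (hasSum_sq_fourierCoeffOn Real.two_pi_pos hL).summable
  simpa only [memL2, fCoeff_eq_fourierCoeffOn] using h

theorem dd_fCoeff {U : ℝ → ℝ} (hU : ContDiff ℝ 2 U)
    (hper : Function.Periodic U (2 * Real.pi)) {n : ℤ} (hn : n ≠ 0) :
    dd (fCoeff U) n = fCoeff (deriv (deriv U)) n := by
  have hU' : ContDiff ℝ 1 (deriv U) := ((contDiff_succ_iff_deriv (n := 1)).1 hU).2.2
  have hper' : Function.Periodic (deriv U) (2 * Real.pi) := fun x => by
    rw [← deriv_comp_add_const]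
    exact congrArg (fun g => deriv g x) (funext hper)
  rw [fCoeff_deriv hU' hper' hn, fCoeff_deriv (hU.of_le one_le_two) hper hn, dd]
  linear_combination (-(n : ℂ) ^ 2 * fCoeff U n) * Complex.I_sq

theorem memL2_dd_fCoeff {U : ℝ → ℝ} (hU : ContDiff ℝ 2 U)
    (hper : Function.Periodic U (2 * Real.pi)) : memL2 (dd (fCoeff U)) := by
  have hU' : ContDiff ℝ 1 (deriv U) := ((contDiff_succ_iff_deriv (n := 1)).1 hU).2.2
  refine (memL2_fCoeff (hU'.continuous_deriv le_rfl)).of_nonneg_of_le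
    (fun n => by positivity) fun n => ?_
  rcases eq_or_ne n 0 with rfl | hn
  · simp [dd]
  · rw [dd_fCoeff hU hper hn]

/-- The Fourier coefficients are absolutely summable when those of the second derivative are
square summable. -/
theorem summable_norm_of_memL2_dd {c : FC} (h : memL2 (dd c)) : Summable fun j => ‖c j‖ := by
  have h2 : Summable fun j : ℤ => 1 / (j : ℝ) ^ 2 :=
    Real.summable_one_div_int_pow.2 one_lt_two
  refine Summable.of_norm_bounded_eventually (h.add h2) ?_
  filter_upwards [(Set.finite_singleton (0 : ℤ)).compl_mem_cofinite] with j hj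
  have hj0 : j ≠ 0 := hj
  have hj1 : (1 : ℝ) ≤ (j : ℝ) ^ 2 := by
    exact_mod_cast Int.one_le_abs (pow_ne_zero 2 hj0) |>.trans_eq (abs_of_nonneg (sq_nonneg j))
  have hc : ‖dd c j‖ = (j : ℝ) ^ 2 * ‖c j‖ := by simp [dd]
  rw [hc, norm_norm]
  have h3 : 0 < 1 / (j : ℝ) ^ 2 := by positivity
  have h4 : (j : ℝ) ^ 2 * (1 / (j : ℝ) ^ 2) = 1 := by field_simp
  nlinarith [sq_nonneg ((j : ℝ) ^ 2 * ‖c j‖ - 1 / (j : ℝ) ^ 2), norm_nonneg (c j),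
    sq_nonneg ((j : ℝ) ^ 2 * ‖c j‖), sq_nonneg (1 / (j : ℝ) ^ 2)]

/-- `(𝒟_ε - ζ)⁻¹` gains two derivatives. -/
theorem memHs_two_of_memL2_mul (ε : ℝ) (ζ : ℂ) {c : FC}
    (h : memL2 fun j => ((((j : ℝ) ^ 2 + ε ^ 2 : ℝ) : ℂ) + ζ) * c j) : memHs 2 c := by
  refine Summable.of_norm_bounded_eventually (h.mul_left 4) ?_
  have hfin : {j : ℤ | (j : ℝ) ^ 2 < 1 + 2 * ‖ζ‖}.Finite := by
    refine (Set.finite_Icc (-⌈1 + 2 * ‖ζ‖⌉) ⌈1 + 2 * ‖ζ‖⌉).subset fun j hj => ?_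
    have h1 : j ^ 2 < ⌈1 + 2 * ‖ζ‖⌉ := by
      have : ((j ^ 2 : ℤ) : ℝ) < 1 + 2 * ‖ζ‖ := by exact_mod_cast hj
      exact_mod_cast this.trans_le (Int.le_ceil _)
    constructor <;> nlinarith
  filter_upwards [hfin.compl_mem_cofinite] with j hj
  have hj' : 1 + 2 * ‖ζ‖ ≤ (j : ℝ) ^ 2 := not_lt.1 hj
  have h1 : (j : ℝ) ^ 2 + ε ^ 2 - ‖ζ‖ ≤ ‖(((j : ℝ) ^ 2 + ε ^ 2 : ℝ) : ℂ) + ζ‖ := by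
    have := norm_sub_le_norm_add (((j : ℝ) ^ 2 + ε ^ 2 : ℝ) : ℂ) ζ
    rwa [Complex.norm_real, Real.norm_of_nonneg (by positivity)] at this
  have h2 : 1 + (j : ℝ) ^ 2 ≤ 2 * ‖(((j : ℝ) ^ 2 + ε ^ 2 : ℝ) : ℂ) + ζ‖ := by
    nlinarith [sq_nonneg ε]
  rw [Real.norm_of_nonneg (by positivity), Real.rpow_two, norm_mul, mul_pow, ← mul_assoc]
  gcongr
  calc (1 + (j : ℝ) ^ 2) ^ 2 ≤ (2 * ‖(((j : ℝ) ^ 2 + ε ^ 2 : ℝ) : ℂ) + ζ‖) ^ 2 := by gcongr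
    _ = _ := by ring

theorem memL2.add {f g : FC} (hf : memL2 f) (hg : memL2 g) : memL2 fun j => f j + g j := by
  refine ((Summable.add hf hg).mul_left 2).of_nonneg_of_le (fun j => by positivity) fun j => ?_
  calc ‖f j + g j‖ ^ 2 ≤ (‖f j‖ + ‖g j‖) ^ 2 := by gcongr; exact norm_add_le _ _
    _ ≤ 2 * (‖f j‖ ^ 2 + ‖g j‖ ^ 2) := add_sq_le

theorem memL2.const_mul {f : FC} (hf : memL2 f) (a : ℂ) : memL2 fun j => a * f j := by
  simpa only [memL2, norm_mul, mul_pow] using Summable.mul_left (‖a‖ ^ 2) hf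

theorem mul_sq_le_norm_add (ε : ℝ) {z : ℂ} (hz : -1 < z.re) {j : ℤ} (hj : j ≠ 0) :
    min (ε ^ 2) 1 * (j : ℝ) ^ 2 ≤ ‖(((j : ℝ) ^ 2 + ε ^ 2 : ℝ) : ℂ) + z‖ := by
  have hj1 : (1 : ℝ) ≤ (j : ℝ) ^ 2 := by
    exact_mod_cast Int.one_le_abs (pow_ne_zero 2 hj) |>.trans_eq (abs_of_nonneg (sq_nonneg j))
  have h1 := Complex.re_le_norm ((((j : ℝ) ^ 2 + ε ^ 2 : ℝ) : ℂ) + z)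
  rw [Complex.add_re, Complex.ofReal_re] at h1
  nlinarith [min_le_left (ε ^ 2) 1, min_le_right (ε ^ 2) 1]

theorem norm_uEps_le {ε : ℝ} (hε : 0 < ε) (c : FC) {z : ℂ} (hz : -1 < z.re) (j : ℤ) :
    ‖uEps ε z c j‖ ≤ (min (ε ^ 2) 1)⁻¹ * ‖c j‖ := by
  have hm : 0 < min (ε ^ 2) 1 := by positivity
  rcases eq_or_ne j 0 with rfl | hj
  · simp only [uEps, Int.cast_zero, ne_eq, OfNat.ofNat_ne_zero, not_false_eq_true, zero_pow,
      zero_mul, zero_div, norm_zero]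
    positivity
  have hj2 : 0 < (j : ℝ) ^ 2 := by positivity
  have h := mul_sq_le_norm_add ε hz hj
  have hpos : 0 < ‖(((j : ℝ) ^ 2 + ε ^ 2 : ℝ) : ℂ) + z‖ := (mul_pos hm hj2).trans_le h
  have hn : ‖(j : ℂ) ^ 2‖ = (j : ℝ) ^ 2 := by simp
  rw [uEps, norm_div, norm_mul, hn, div_le_iff₀ hpos]
  calc (j : ℝ) ^ 2 * ‖c j‖
      = (min (ε ^ 2) 1)⁻¹ * ‖c j‖ * (min (ε ^ 2) 1 * (j : ℝ) ^ 2) := by field_simp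
    _ ≤ _ := by gcongr

theorem differentiableOn_uEps {ε : ℝ} (hε : 0 < ε) (c : FC) (j : ℤ) :
    DifferentiableOn ℂ (fun z => uEps ε z c j) {z : ℂ | -1 < z.re} := by
  rcases eq_or_ne j 0 with rfl | hj
  · simp [uEps]
  intro z hz
  have hm : 0 < min (ε ^ 2) 1 * (j : ℝ) ^ 2 := by positivity
  have h0 : (((j : ℝ) ^ 2 + ε ^ 2 : ℝ) : ℂ) + z ≠ 0 :=
    norm_pos_iff.1 (hm.trans_le (mul_sq_le_norm_add ε hz hj))
  exact ((differentiableAt_const _).div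
    ((differentiableAt_const _).add differentiableAt_id) h0).differentiableWithinAt

theorem exists_analyticOnNhd_lp_uEps {ε : ℝ} (hε : 0 < ε) {c : FC}
    (hc : Summable fun j => ‖c j‖) :
    ∃ F : ℂ → lp (fun _ : ℤ => ℂ) 2,
      AnalyticOnNhd ℂ F {z : ℂ | -1 < z.re} ∧
      ∀ z ∈ {z : ℂ | -1 < z.re}, ∀ m : ℤ, (F z : ℤ → ℂ) m = uEps ε z c m := by
  have hopen : IsOpen {z : ℂ | -1 < z.re} := isOpen_lt continuous_const Complex.continuous_re
  have hsum : Summable fun j => (min (ε ^ 2) 1)⁻¹ * ‖c j‖ := hc.mul_left _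
  let G : ℤ → ℂ → lp (fun _ : ℤ => ℂ) 2 := fun j z => lp.single 2 j (uEps ε z c j)
  have hG : ∀ j, ∀ z ∈ {z : ℂ | -1 < z.re}, ‖G j z‖ ≤ (min (ε ^ 2) 1)⁻¹ * ‖c j‖ :=
    fun j z hz => (lp.norm_single (by norm_num) j _).trans_le (norm_uEps_le hε c hz j)
  have hdiff : ∀ j, DifferentiableOn ℂ (G j) {z : ℂ | -1 < z.re} := fun j =>
    (lp.singleContinuousLinearMap ℂ (fun _ : ℤ => ℂ) 2 j).differentiable.comp_differentiableOn
      (differentiableOn_uEps hε c j)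
  refine ⟨fun z => ∑' j, G j z, (Complex.differentiableOn_tsum_of_summable_norm hsum hdiff hopen
    hG).analyticOnNhd hopen, fun z hz m => ?_⟩
  have hs : Summable fun j => G j z := .of_norm_bounded hsum fun j => hG j z hz
  have h := (lp.evalCLM ℂ (fun _ : ℤ => ℂ) 2 m).map_tsum hs
  refine h.trans ((tsum_eq_single m fun j hj => ?_).trans ?_)
  · exact lp.single_apply_ne 2 j _ hj.symm
  · exact lp.single_apply_self 2 m _

/-- Lemma 2.6: if `ζ ∈ ρ_{L²}(𝒟_ε)` then `νζ ∈ ρ_{L²}(ℳ_{ν,ε})` and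
the resolvent of `ℳ_{ν,ε}` is given by the Sherman–Morrison formula above; moreover
`u_ε(ζ,·) = U + (ε²+ζ)(𝒟_ε-ζ)⁻¹U`, and `ζ ↦ u_ε(ζ,·)` is analytic on `{Re z > -1}`
with values in `L²(𝕋)` (modelled as `ℓ²(ℤ)`). -/
theorem statement5 (U : ℝ → ℝ) (hU : ContDiff ℝ 2 U)
    (hper : Function.Periodic U (2 * Real.pi))
    (havg : (∫ y in (0:ℝ)..(2 * Real.pi), U y) = 0)
    (ν ε : ℝ) (hν : 0 < ν) (hε : 0 < ε)
    (ζ : ℂ) (hζ : ∀ j : ℤ, ζ ≠ -(((j : ℝ) ^ 2 + ε ^ 2 : ℝ) : ℂ)) :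
    -- `resM` is a two-sided inverse of `ℳ_{ν,ε} - νζ`, so `νζ ∈ ρ_{L²}(ℳ_{ν,ε})`:
    (∀ f : FC, memL2 f →
        memHs 2 (resM ν ε ζ (fCoeff U) f) ∧
        ∀ m, Mop ν ε (fCoeff U) (resM ν ε ζ (fCoeff U) f) m
              - (ν : ℂ) * ζ * resM ν ε ζ (fCoeff U) f m = f m) ∧
    (∀ f : FC, memHs 2 f →
        ∀ m, resM ν ε ζ (fCoeff U)
            (fun m' => Mop ν ε (fCoeff U) f m' - (ν : ℂ) * ζ * f m') m = f m) ∧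
    -- `u_ε(ζ,·) = U + (ε²+ζ)(𝒟_ε - ζ)⁻¹ U`:
    (∀ m, uEps ε ζ (fCoeff U) m
        = fCoeff U m + (((ε ^ 2 : ℝ) : ℂ) + ζ)
            * (fCoeff U m / (-(((m : ℝ) ^ 2 + ε ^ 2 : ℝ) : ℂ) - ζ))) ∧
    -- analyticity of `ζ ↦ u_ε(ζ,·)` on `{Re z > -1}`, with values in `L²`:
    (∃ F : ℂ → lp (fun _ : ℤ => ℂ) 2,
        AnalyticOnNhd ℂ F {z : ℂ | -1 < z.re} ∧
        ∀ ζ' ∈ {z : ℂ | -1 < z.re}, ∀ m : ℤ, (F ζ' : ℤ → ℂ) m = uEps ε ζ' (fCoeff U) m) := by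
  have hA : ∀ j : ℤ, (((j : ℝ) ^ 2 + ε ^ 2 : ℝ) : ℂ) + ζ ≠ 0 := fun j h =>
    hζ j (eq_neg_of_add_eq_zero_right h)
  have hA0 : ((ε ^ 2 : ℝ) : ℂ) + ζ ≠ 0 := by simpa using hA 0
  have hν' : (ν : ℂ) ≠ 0 := by exact_mod_cast hν.ne'
  have hε' : (ε : ℂ) ≠ 0 := by exact_mod_cast hε.ne'
  have hdd := memL2_dd_fCoeff hU hper
  generalize fCoeff U = c at *
  have hneg : ∀ j : ℤ, -(((j : ℝ) ^ 2 + ε ^ 2 : ℝ) : ℂ) - ζ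
      = -((((j : ℝ) ^ 2 + ε ^ 2 : ℝ) : ℂ) + ζ) := fun j => by ring
  have hres : ∀ (f : FC) (j : ℤ), ((((j : ℝ) ^ 2 + ε ^ 2 : ℝ) : ℂ) + ζ) * resM ν ε ζ c f j
      = (-1 / (ν : ℂ)) * f j
        + (-(f 0 / (Complex.I * (ε : ℂ) * (ν : ℂ) ^ 2 * (((ε ^ 2 : ℝ) : ℂ) + ζ)))) * dd c j := by
    intro f j
    have hj := hA j
    rw [resM, uEps, dd, hneg]
    generalize (((j : ℝ) ^ 2 + ε ^ 2 : ℝ) : ℂ) + ζ = A at *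
    generalize ((ε ^ 2 : ℝ) : ℂ) + ζ = A₀ at *
    field_simp
  have hres0 : ∀ f : FC, resM ν ε ζ c f 0 = -(f 0 / ((ν : ℂ) * (((ε ^ 2 : ℝ) : ℂ) + ζ))) := by
    intro f
    have h := hres f 0
    have hd0 : dd c 0 = 0 := by simp [dd]
    rw [hd0, Int.cast_zero, zero_pow two_ne_zero, zero_add] at h
    apply mul_left_cancel₀ hA0
    rw [h]
    generalize ((ε ^ 2 : ℝ) : ℂ) + ζ = A₀ at *
    field_simp
    ring
  refine ⟨fun f hf => ⟨?_, fun m => ?_⟩, fun f _ m => ?_, fun m => ?_,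
    exists_analyticOnNhd_lp_uEps hε (summable_norm_of_memL2_dd hdd)⟩
  · refine memHs_two_of_memL2_mul ε ζ ?_
    simp only [hres]
    exact (hf.const_mul _).add (hdd.const_mul _)
  · have h := hres f m
    rw [Mop, Dop, hres0]
    have hI : f 0 / (Complex.I * (ε : ℂ) * (ν : ℂ) ^ 2 * (((ε ^ 2 : ℝ) : ℂ) + ζ))
        = -Complex.I / (ε : ℂ) * (f 0 / ((ν : ℂ) * (((ε ^ 2 : ℝ) : ℂ) + ζ))) / (ν : ℂ) := by
      generalize ((ε ^ 2 : ℝ) : ℂ) + ζ = A₀ at *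
      field_simp
      simp
    rw [hI] at h
    generalize f 0 / ((ν : ℂ) * (((ε ^ 2 : ℝ) : ℂ) + ζ)) = q at *
    have h1 : (ν : ℂ) * (-1 / (ν : ℂ)) = -1 := by field_simp
    have h2 : (ν : ℂ) * (-Complex.I / (ε : ℂ) * q / (ν : ℂ)) = -Complex.I / (ε : ℂ) * q := by
      field_simp
    linear_combination (-(ν : ℂ)) * h - f m * h1 + dd c m * h2
  · apply mul_left_cancel₀ (hA m)
    rw [hres]
    simp only [Mop, Dop, dd, Int.cast_zero, zero_pow two_ne_zero, zero_add]
    have e0 : (ν : ℂ) * (-((ε ^ 2 : ℝ) : ℂ) * f 0) - Complex.I / (ε : ℂ) * f 0 * (-0 * c 0)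
        - (ν : ℂ) * ζ * f 0 = -(ν : ℂ) * (((ε ^ 2 : ℝ) : ℂ) + ζ) * f 0 := by ring
    rw [e0]
    generalize ((ε ^ 2 : ℝ) : ℂ) + ζ = A₀ at *
    generalize (((m : ℝ) ^ 2 + ε ^ 2 : ℝ) : ℂ) = B at *
    field_simp
    linear_combination (-(f 0 * (m : ℂ) ^ 2 * c m)) * Complex.I_sq
  · have hm := hA m
    rw [uEps, hneg]
    have hsplit : (((m : ℝ) ^ 2 + ε ^ 2 : ℝ) : ℂ) = (m : ℂ) ^ 2 + ((ε ^ 2 : ℝ) : ℂ) := by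
      push_cast; ring
    rw [hsplit] at hm ⊢
    field_simp
    ring

end
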